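/- (Orthogonality in exceptional triples.) With e_α, e_γ, e_β the exceptional characters associated to (p−1)/2ⁿ, p/2ⁿ and (p+1)/2ⁿ respectively, one has χ(e_γ, e_α) = 0, χ(e_β, e_α) = 0 and χ(e_β, e_γ) = 0. -/

import Mathlib

/-- The Euler pairing (Hirzebruch–Riemann–Roch on P²) on `K(P²)⊗ℝ ≅ ℝ³`,
identifying `v = (ch₀ v, ch₁ v, ch₂ v)`. -/
noncomputable def chi (v w : ℝ × ℝ × ℝ) : ℝ :=
  v.2.2 * w.1 + w.2.2 * v.1 - v.2.1 * w.2.1 + (3 / 2) * (w.2.1 * v.1 - w.1 * v.2.1) + v.1 * w.1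

/-- `vtil m p` is the exceptional character `ṽ(p / 2^m) ∈ ℝ³`, defined recursively:
`ṽ(n) = (1, n, n²/2)` for integers `n`; for odd `p` and `m > 0`,
if `p ≡ 3 (mod 4)` then `ṽ(p/2^m) = 3·ch₀(ṽ((p+1)/2^m))·ṽ((p−1)/2^m) − ṽ((p−3)/2^m)`,
and if `p ≡ 1 (mod 4)` then `ṽ(p/2^m) = 3·ch₀(ṽ((p−1)/2^m))·ṽ((p+1)/2^m) − ṽ((p+3)/2^m)`.
For even `p` we reduce the fraction, so `vtil` is well defined on dyadic rationals
(each dyadic rational `q` is represented as `p / 2^m`). -/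
noncomputable def vtil : ℕ → ℤ → ℝ × ℝ × ℝ
  | 0, p => (1, (p : ℝ), (p : ℝ) ^ 2 / 2)
  | m + 1, p =>
    if p % 2 = 0 then vtil m (p / 2)
    else if p % 4 = 3 then
      (3 * (vtil m ((p + 1) / 2)).1) • vtil m ((p - 1) / 2) - vtil m ((p - 3) / 2)
    else
      (3 * (vtil m ((p - 1) / 2)).1) • vtil m ((p + 1) / 2) - vtil m ((p + 3) / 2)

theorem chi_sub_left (u v w : ℝ × ℝ × ℝ) : chi (u - v) w = chi u w - chi v w := by
  simp only [chi, Prod.fst_sub, Prod.snd_sub]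
  ring

theorem chi_sub_right (u v w : ℝ × ℝ × ℝ) : chi u (v - w) = chi u v - chi u w := by
  simp only [chi, Prod.fst_sub, Prod.snd_sub]
  ring

theorem chi_smul_left (c : ℝ) (v w : ℝ × ℝ × ℝ) : chi (c • v) w = c * chi v w := by
  simp only [chi, Prod.smul_fst, Prod.smul_snd, smul_eq_mul]
  ring

theorem chi_smul_right (c : ℝ) (v w : ℝ × ℝ × ℝ) : chi v (c • w) = c * chi v w := by
  simp only [chi, Prod.smul_fst, Prod.smul_snd, smul_eq_mul]
  ring

/-- Numerical exceptional triples `(a, c, b)` for the Euler pairing whose remaining pairings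
are expressed through the ranks as for Markov triples. -/
structure IsMarkovTriple (a c b : ℝ × ℝ × ℝ) : Prop where
  chi_aa : chi a a = 1
  chi_cc : chi c c = 1
  chi_bb : chi b b = 1
  chi_ca : chi c a = 0
  chi_ba : chi b a = 0
  chi_bc : chi b c = 0
  chi_ac : chi a c = 3 * b.1
  chi_cb : chi c b = 3 * a.1
  chi_ab : chi a b = 9 * a.1 * b.1 - 3 * c.1

namespace IsMarkovTriple

variable {a c b : ℝ × ℝ × ℝ}

/-- Mutation of `a` across `c`. -/
theorem mutate_left (h : IsMarkovTriple a c b) :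
    IsMarkovTriple c ((3 * b.1) • c - a) b := by
  obtain ⟨haa, hcc, hbb, hca, hba, hbc, hac, hcb, hab⟩ := h
  constructor <;>
    simp only [chi_sub_left, chi_sub_right, chi_smul_left, chi_smul_right, haa, hcc, hbb, hca,
      hba, hbc, hac, hcb, hab, Prod.fst_sub, Prod.smul_fst, smul_eq_mul] <;>
    ring

/-- Mutation of `b` across `c`. -/
theorem mutate_right (h : IsMarkovTriple a c b) :
    IsMarkovTriple a ((3 * a.1) • c - b) c := by
  obtain ⟨haa, hcc, hbb, hca, hba, hbc, hac, hcb, hab⟩ := h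
  constructor <;>
    simp only [chi_sub_left, chi_sub_right, chi_smul_left, chi_smul_right, haa, hcc, hbb, hca,
      hba, hbc, hac, hcb, hab, Prod.fst_sub, Prod.smul_fst, smul_eq_mul] <;>
    ring

end IsMarkovTriple

theorem vtil_succ_two_mul (m : ℕ) (k : ℤ) : vtil (m + 1) (2 * k) = vtil m k := by
  rw [vtil, if_pos (by omega), show 2 * k / 2 = k by omega]

theorem vtil_succ_of_odd (m : ℕ) {k : ℤ} (hk : Odd k) :
    vtil (m + 1) (2 * k + 1) = (3 * (vtil m (k + 1)).1) • vtil m k - vtil m (k - 1) := by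
  obtain ⟨j, rfl⟩ := hk
  rw [vtil, if_neg (by omega), if_pos (by omega),
    show (2 * (2 * j + 1) + 1 + 1) / 2 = 2 * j + 1 + 1 by omega,
    show (2 * (2 * j + 1) + 1 - 1) / 2 = 2 * j + 1 by omega,
    show (2 * (2 * j + 1) + 1 - 3) / 2 = 2 * j + 1 - 1 by omega]

theorem vtil_succ_of_even (m : ℕ) {k : ℤ} (hk : Even k) :
    vtil (m + 1) (2 * k + 1) = (3 * (vtil m k).1) • vtil m (k + 1) - vtil m (k + 2) := by
  obtain ⟨j, rfl⟩ := hk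
  rw [vtil, if_neg (by omega), if_neg (by omega),
    show (2 * (j + j) + 1 - 1) / 2 = j + j by omega,
    show (2 * (j + j) + 1 + 1) / 2 = j + j + 1 by omega,
    show (2 * (j + j) + 1 + 3) / 2 = j + j + 2 by omega]

theorem isMarkovTriple_vtil (n : ℕ) (p : ℤ) (hp : 0 < n → Odd p) :
    IsMarkovTriple (vtil n (p - 1)) (vtil n p) (vtil n (p + 1)) := by
  induction n generalizing p with
  | zero =>
    constructor <;> simp only [vtil, chi] <;> push_cast <;> ring
  | succ m ih =>
    obtain ⟨k, rfl⟩ := hp m.succ_pos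
    rw [show 2 * k + 1 - 1 = 2 * k by ring, show 2 * k + 1 + 1 = 2 * (k + 1) by ring,
      vtil_succ_two_mul, vtil_succ_two_mul]
    rcases Int.even_or_odd k with hk | hk
    · have h := (ih (k + 1) fun _ => hk.add_one).mutate_right
      rw [add_sub_cancel_right, add_assoc k 1 1, one_add_one_eq_two] at h
      rwa [vtil_succ_of_even m hk]
    · rw [vtil_succ_of_odd m hk]
      exact (ih k fun _ => hk).mutate_left

/-- Orthogonality in exceptional triples: with `e_α = ṽ((p−1)/2ⁿ)`, `e_γ = ṽ(p/2ⁿ)`,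
`e_β = ṽ((p+1)/2ⁿ)` (`p` odd when `n > 0`), one has
`χ(e_γ, e_α) = 0`, `χ(e_β, e_α) = 0` and `χ(e_β, e_γ) = 0`. -/
theorem exceptional_triple_orthogonality (n : ℕ) (p : ℤ) (hp : 0 < n → Odd p) :
    chi (vtil n p) (vtil n (p - 1)) = 0 ∧
    chi (vtil n (p + 1)) (vtil n (p - 1)) = 0 ∧
    chi (vtil n (p + 1)) (vtil n p) = 0 := by
  have h := isMarkovTriple_vtil n p hp
  exact ⟨h.chi_ca, h.chi_ba, h.chi_bc⟩
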